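/- arXiv:1803.01590 — 2 statements merged into one kernel-verified Lean document; each statement's English description precedes it below -/
import Mathlib

section
/- For every positive integer n and every integer k with 0 ≤ k ≤ n, the polynomial identity [n−k+1]_q · Σ_{T ∈ RInc_k(2×n)} q^{amaj(T)} = q^{k(k−1)/2} · [2n−k choose k]_q · [2n−2k choose n−k]_q holds in ℤ[q]. -/
open Polynomial

/-- The q-integer `[n]_q = 1 + q + ⋯ + q^(n-1)` in `ℤ[q]`. -/
noncomputable def qInt (n : ℕ) : Polynomial ℤ := ∑ i ∈ Finset.range n, X ^ i

/-- The Gaussian binomial coefficient `[a choose b]_q` in `ℤ[q]`, defined by the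
standard q-Pascal recurrence `[n+1 choose k+1] = [n choose k] + q^(k+1) [n choose k+1]`. -/
noncomputable def qBinom : ℕ → ℕ → Polynomial ℤ
  | _, 0 => 1
  | 0, _ + 1 => 0
  | n + 1, k + 1 => qBinom n k + X ^ (k + 1) * qBinom n (k + 1)

/-- Amajor index: sum of all `i` such that `i` appears in row 2 and `i+1` appears in row 1. -/
def amaj {n : ℕ} (T : (Fin n → ℕ) × (Fin n → ℕ)) : ℕ :=
  ∑ i ∈ (Finset.image T.2 Finset.univ).filter (fun i => ∃ j, T.1 j = i + 1), i

/-- Row-increasing tableaux of shape 2×n with entry set `{1, …, 2n−k}`: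
rows strictly increasing, columns weakly increasing. -/
def RInc (n k : ℕ) : Set ((Fin n → ℕ) × (Fin n → ℕ)) :=
  {T | StrictMono T.1 ∧ StrictMono T.2 ∧ (∀ i, T.1 i ≤ T.2 i) ∧
    Set.range T.1 ∪ Set.range T.2 = Set.Icc 1 (2 * n - k)}


/-! ### q-arithmetic -/

lemma qInt_zero : qInt 0 = 0 := by simp [qInt]

lemma qInt_add (a b : ℕ) : qInt (a + b) = qInt a + X ^ a * qInt b := by
  simp [qInt, Finset.sum_range_add, Finset.mul_sum, pow_add]

lemma qInt_mul (a : ℕ) : qInt a * (X - 1) = X ^ a - 1 := by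
  simpa [qInt] using geom_sum_mul (X : Polynomial ℤ) a

lemma qInt_succ_ne (a : ℕ) : qInt (a + 1) ≠ 0 := by
  intro h
  have := congrArg (Polynomial.eval 1) h
  simp [qInt, Polynomial.eval_finsetSum] at this
  omega

/-- The q-factorial. -/
noncomputable def qFac (n : ℕ) : Polynomial ℤ := ∏ i ∈ Finset.range n, qInt (i + 1)

lemma qFac_zero : qFac 0 = 1 := by simp [qFac]

lemma qFac_succ (n : ℕ) : qFac (n + 1) = qFac n * qInt (n + 1) := by
  simp [qFac, Finset.prod_range_succ]

lemma qFac_ne (n : ℕ) : qFac n ≠ 0 :=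
  Finset.prod_ne_zero_iff.2 fun i _ => qInt_succ_ne i

lemma qBinom_zero_right (n : ℕ) : qBinom n 0 = 1 := by cases n <;> simp [qBinom]

lemma qBinom_lt : ∀ (n k : ℕ), n < k → qBinom n k = 0
  | _, 0, h => by omega
  | 0, _ + 1, _ => by simp [qBinom]
  | n + 1, k + 1, h => by
    simp [qBinom, qBinom_lt n k (by omega), qBinom_lt n (k + 1) (by omega)]

lemma qBinom_fac : ∀ (s a b : ℕ), a + b = s → qBinom (a + b) b * (qFac a * qFac b) = qFac (a + b)
  | _, a, 0, _ => by simp [qBinom_zero_right, qFac_zero]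
  | 0, a, b + 1, h => by omega
  | s + 1, 0, b + 1, h => by
    have h1 := qBinom_fac s 0 b (by omega)
    rw [zero_add] at h1 ⊢
    rw [qBinom, qBinom_lt b (b + 1) (by omega), qFac_succ]
    linear_combination qInt (b + 1) * h1
  | s + 1, a + 1, b + 1, h => by
    have h1 := qBinom_fac s (a + 1) b (by omega)
    have h2 := qBinom_fac s a (b + 1) (by omega)
    have e1 : a + 1 + (b + 1) = (a + 1 + b) + 1 := by ring
    have e2 : a + (b + 1) = a + 1 + b := by ring
    rw [e2] at h2
    have h3 : qInt (a + 1 + b + 1) = qInt (b + 1) + X ^ (b + 1) * qInt (a + 1) := by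
      rw [← qInt_add]; congr 1; ring
    rw [e1, qBinom, qFac_succ (a + 1 + b), h3]
    rw [qFac_succ b, qFac_succ a] at *
    linear_combination qInt (b + 1) * h1 + X ^ (b + 1) * qInt (a + 1) * h2

/-- q-trinomial coefficient. -/
noncomputable def tri (u d k : ℕ) : Polynomial ℤ := qBinom (u + d + k) k * qBinom (u + d) d

lemma tri_fac (u d k : ℕ) : tri u d k * (qFac u * qFac d * qFac k) = qFac (u + d + k) := by
  rw [← qBinom_fac _ (u + d) k rfl, ← qBinom_fac _ u d rfl, tri]; ring

lemma tri_comm (u d k : ℕ) : tri u d k = tri d u k := by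
  apply mul_right_cancel₀ (mul_ne_zero (mul_ne_zero (qFac_ne u) (qFac_ne d)) (qFac_ne k))
  rw [tri_fac, add_comm u d, ← tri_fac d u k]; ring

lemma tri_u (u d k : ℕ) : qInt (u + 1) * tri (u + 1) d k = qInt (u + d + k + 1) * tri u d k := by
  apply mul_right_cancel₀ (mul_ne_zero (mul_ne_zero (qFac_ne u) (qFac_ne d)) (qFac_ne k))
  have h1 := tri_fac u d k
  have h2 := tri_fac (u + 1) d k
  rw [show u + 1 + d + k = u + d + k + 1 by ring, qFac_succ, qFac_succ] at h2
  linear_combination h2 - qInt (u + d + k + 1) * h1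

lemma tri_d (u d k : ℕ) : qInt (d + 1) * tri u (d + 1) k = qInt (u + d + k + 1) * tri u d k := by
  rw [tri_comm u (d + 1), tri_comm u d, tri_u, add_comm d u]

lemma tri_k (u d k : ℕ) : qInt (k + 1) * tri u d (k + 1) = qInt (u + d + k + 1) * tri u d k := by
  apply mul_right_cancel₀ (mul_ne_zero (mul_ne_zero (qFac_ne u) (qFac_ne d)) (qFac_ne k))
  have h1 := tri_fac u d k
  have h2 := tri_fac u d (k + 1)
  rw [← add_assoc, qFac_succ, qFac_succ] at h2
  linear_combination h2 - qInt (u + d + k + 1) * h1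

/-- Unrestricted total. -/
noncomputable def tot (u d k : ℕ) : Polynomial ℤ := X ^ (k.choose 2) * tri u d k

/-- Unrestricted sum of words ending with a letter of row 1 only (or empty). -/
noncomputable def totU : ℕ → ℕ → ℕ → Polynomial ℤ
  | 0, d, k => if d = 0 ∧ k = 0 then 1 else 0
  | u + 1, d, k => X ^ (k.choose 2 + d + k) * tri u d k

/-- `tot` with `d` decreased -/
noncomputable def totD : ℕ → ℕ → ℕ → Polynomial ℤ
  | _, 0, _ => 0
  | u, d + 1, k => tot u d k

/-- the sum for last letter in both rows -/
noncomputable def totB : ℕ → ℕ → ℕ → Polynomial ℤ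
  | _, _, 0 => 0
  | u, d, k + 1 => totU (u + 1) d k

lemma rec1 (u d k : ℕ) :
    totU (u + 1) d k = totU u d k + X ^ (u + d + k) * (tot u d k - totU u d k) := by
  rcases u with _ | u
  · by_cases h : d = 0 ∧ k = 0
    · obtain ⟨rfl, rfl⟩ := h
      simp [totU, tot, tri, qBinom]
    · simp only [totU, tot, if_neg h]
      ring
  · simp only [totU, tot]
    have h := tri_u u d k
    have h1 := qInt_mul (u + 1)
    have h2 := qInt_mul (u + d + k + 1)
    have e : u + 1 + d + k = u + d + k + 1 := by ring
    rw [e]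
    linear_combination X ^ (k.choose 2 + d + k) * (- (X - 1) * h + h1 * tri (u + 1) d k -
      h2 * tri u d k)

lemma rec2 (u d k : ℕ) (h : 0 < u + d + k) :
    tot u d k - totU u d k = totD u d k + totB u d k := by
  obtain ⟨N, hN⟩ : ∃ N, u + d + k = N + 1 := ⟨u + d + k - 1, by omega⟩
  apply mul_left_cancel₀ (qInt_succ_ne N)
  have hI : qInt (N + 1) = qInt d + X ^ d * qInt k + X ^ (d + k) * qInt u := by
    rw [← hN, show u + d + k = d + k + u by ring, qInt_add, qInt_add]
  have hU : qInt (N + 1) * totU u d k = X ^ (d + k) * qInt u * tot u d k := by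
    rcases u with _ | u
    · simp only [totU, qInt_zero]
      rw [if_neg (by omega)]; ring
    · have h := tri_u u d k
      rw [show u + d + k = N by omega] at h
      simp only [totU, tot]
      linear_combination - X ^ (k.choose 2 + d + k) * h
  have hD : qInt (N + 1) * totD u d k = qInt d * tot u d k := by
    rcases d with _ | d
    · simp [totD, qInt_zero]
    · have h := tri_d u d k
      rw [show u + d + k = N by omega] at h
      simp only [totD, tot]
      linear_combination - X ^ (k.choose 2) * h
  have hB : qInt (N + 1) * totB u d k = X ^ d * qInt k * tot u d k := by
    rcases k with _ | k
    · simp [totB, qInt_zero]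
    · have h := tri_k u d k
      rw [show u + d + k = N by omega] at h
      simp only [totB, totU, tot]
      have e : (k + 1).choose 2 = k.choose 2 + k := by
        rw [Nat.choose_succ_succ' k 1]; simp; ring
      rw [e]
      linear_combination - X ^ (k.choose 2 + k + d) * h
  linear_combination hI * tot u d k - hU - hD - hB

/-- restricted: formula for words ending in U -/
noncomputable def fU : ℕ → ℕ → ℕ → Polynomial ℤ
  | u, 0, k => totU u 0 k
  | u, d + 1, k => totU u (d + 1) k - X * totU (u + 1) d k

/-- restricted: formula for all words -/
noncomputable def fT : ℕ → ℕ → ℕ → Polynomial ℤ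
  | u, 0, k => tot u 0 k
  | u, d + 1, k => tot u (d + 1) k - X * tot (u + 1) d k

lemma fU_rec (u d k : ℕ) :
    fU (u + 1) d k = fU u d k + X ^ (u + d + k) * (fT u d k - fU u d k) := by
  rcases d with _ | d
  · simp only [fU, fT]; exact rec1 u 0 k
  · simp only [fU, fT]
    have h1 := rec1 u (d + 1) k
    have h2 := rec1 (u + 1) d k
    rw [show u + 1 + d + k = u + (d + 1) + k by ring] at h2
    linear_combination h1 - X * h2

lemma fU_diag (u k : ℕ) (h : 0 < u + k) : fU u u k = 0 := by
  rcases u with _ | u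
  · simp only [fU, totU]; rw [if_neg (by omega)]
  · simp only [fU, totU]
    rw [tri_comm u (u + 1)]; ring

lemma fT_rec (u d k : ℕ) (h : 0 < u + d + k) :
    fT u d k - fU u d k =
      (match d with | 0 => 0 | d' + 1 => fT u d' k) +
      (match k with | 0 => 0 | k' + 1 => fU (u + 1) d k') := by
  rcases d with _ | d
  · have := rec2 u 0 k h
    rcases k with _ | k <;> simpa [fU, fT, totD, totB] using this
  · have h1 := rec2 u (d + 1) k h
    have h2 := rec2 (u + 1) d k (by omega)
    rcases d with _ | d <;> rcases k with _ | k <;> simp only [fU, fT, totD, totB] at * <;>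
      linear_combination h1 - X * h2

lemma fT_final (m k : ℕ) : qInt (m + 1) * fT m m k = tot m m k := by
  rcases m with _ | m
  · simp [fT, qInt]
  · simp only [fT, tot]
    have h1 := tri_u (m + 1) m k
    have h2 := tri_d (m + 1) m k
    have h3 := qInt_add 1 (m + 1)
    have h4 : qInt 1 = 1 := by simp [qInt]
    rw [add_comm 1, h4] at h3
    linear_combination X ^ (k.choose 2) * (- X * h1 + X * h2 + h3 * tri (m + 1) (m + 1) k)

/-! ### Words as pairs of finite sets -/

/-- The amajor index of a pair of rows. -/
def am (x : Finset ℕ × Finset ℕ) : ℕ := ∑ i ∈ x.2.filter (fun i => i + 1 ∈ x.1), i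

/-- Pairs of rows with entries `1..N`, satisfying the ballot condition; `c` tells whether
`N` lies in row 2. -/
def V : ℕ → Bool → ℕ → ℕ → ℕ → Finset (Finset ℕ × Finset ℕ)
  | 0, false, 0, 0, 0 => {(∅, ∅)}
  | 0, _, _, _, _ => ∅
  | _ + 1, false, 0, _, _ => ∅
  | N + 1, false, u + 1, d, k =>
      (V N false u d k ∪ V N true u d k).image fun x => (insert (N + 1) x.1, x.2)
  | N + 1, true, u, d, k =>
      (if d ≤ u then
        match d with
        | 0 => ∅
        | d' + 1 => (V N false u d' k ∪ V N true u d' k).image fun x => (x.1, insert (N + 1) x.2)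
      else ∅) ∪
      (match k with
        | 0 => ∅
        | k' + 1 => (V N false u d k' ∪ V N true u d k').image
            fun x => (insert (N + 1) x.1, insert (N + 1) x.2))

/-- Characterising predicate of `V`. -/
def P (N : ℕ) (c : Bool) (u d k : ℕ) (A B : Finset ℕ) : Prop :=
  A ∪ B = Finset.Icc 1 N ∧ A.card = u + k ∧ B.card = d + k ∧ u + d + k = N ∧
  (∀ v ≤ N, (B.filter (· ≤ v)).card ≤ (A.filter (· ≤ v)).card) ∧ (c = true ↔ N ∈ B)

lemma P_sub {N c u d k A B} (h : P N c u d k A B) : A ⊆ Finset.Icc 1 N ∧ B ⊆ Finset.Icc 1 N := by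
  rw [← h.1]; exact ⟨Finset.subset_union_left, Finset.subset_union_right⟩

lemma P_le {N c u d k A B} (h : P N c u d k A B) : d ≤ u := by
  have h1 := P_sub h
  have h2 := h.2.2.2.2.1 N le_rfl
  rw [Finset.filter_true_of_mem (fun x hx => (Finset.mem_Icc.1 (h1.1 hx)).2),
    Finset.filter_true_of_mem (fun x hx => (Finset.mem_Icc.1 (h1.2 hx)).2), h.2.1, h.2.2.1] at h2
  omega

lemma filt_insert (A : Finset ℕ) (N v : ℕ) (hv : v ≤ N) :
    (insert (N + 1) A).filter (· ≤ v) = A.filter (· ≤ v) := by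
  rw [Finset.filter_insert, if_neg (by omega)]

/-- Generic extension step. -/
lemma P_step (N : ℕ) (c c' : Bool) (A B A' B' : Finset ℕ) (u d k u' d' k' : ℕ)
    (hA : A' = A ∨ A' = insert (N + 1) A) (hB : B' = B ∨ B' = insert (N + 1) B)
    (hU : A' ∪ B' = insert (N + 1) (A ∪ B))
    (h : P N c u d k A B) (hs : u' + d' + k' = N + 1)
    (hA' : A'.card = u' + k') (hB' : B'.card = d' + k') (hdu : d' ≤ u')
    (hc : c' = true ↔ N + 1 ∈ B') : P (N + 1) c' u' d' k' A' B' := by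
  have hU' : A' ∪ B' = Finset.Icc 1 (N + 1) := by
    rw [hU, h.1]; ext x; simp; omega
  refine ⟨hU', hA', hB', hs, ?_, hc⟩
  intro v hv
  rcases Nat.lt_or_ge N v with h1 | h1
  · obtain rfl : v = N + 1 := by omega
    rw [Finset.filter_true_of_mem, Finset.filter_true_of_mem, hA', hB']
    · omega
    · intro x hx
      have : x ∈ A' ∪ B' := Finset.mem_union_left _ hx
      rw [hU'] at this
      exact (Finset.mem_Icc.1 this).2
    · intro x hx
      have : x ∈ A' ∪ B' := Finset.mem_union_right _ hx
      rw [hU'] at this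
      exact (Finset.mem_Icc.1 this).2
  · have := h.2.2.2.2.1 v h1
    rcases hA with rfl | rfl <;> rcases hB with rfl | rfl <;>
      simpa only [filt_insert _ _ _ h1] using this

/-- Generic restriction step. -/
lemma P_back (N : ℕ) (c : Bool) (A B : Finset ℕ) (u d k u' d' k' : ℕ)
    (h : P (N + 1) c u d k A B) (hs : u' + d' + k' = N)
    (hA' : (A.erase (N + 1)).card = u' + k') (hB' : (B.erase (N + 1)).card = d' + k') :
    P N (decide (N ∈ B.erase (N + 1))) u' d' k' (A.erase (N + 1)) (B.erase (N + 1)) := by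
  refine ⟨?_, hA', hB', hs, ?_, by simp⟩
  · rw [← Finset.erase_union_distrib, h.1]; ext x; simp
  · intro v hv
    have := h.2.2.2.2.1 v (by omega)
    rwa [Finset.filter_erase, Finset.filter_erase, Finset.erase_eq_of_notMem (by simp; omega),
      Finset.erase_eq_of_notMem (by simp; omega)]

lemma mem_union_V {N u d k x} : x ∈ V N false u d k ∪ V N true u d k ↔ ∃ c, x ∈ V N c u d k := by
  simp

lemma P_notMem {N c u d k A B} (h : P N c u d k A B) : N + 1 ∉ A ∧ N + 1 ∉ B := by
  have := P_sub h
  constructor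
  · intro h'; have := Finset.mem_Icc.1 (this.1 h'); omega
  · intro h'; have := Finset.mem_Icc.1 (this.2 h'); omega

lemma mem_V : ∀ (N : ℕ) (c : Bool) (u d k : ℕ) (A B : Finset ℕ),
    (A, B) ∈ V N c u d k ↔ P N c u d k A B := by
  intro N
  induction N with
  | zero =>
    intro c u d k A B
    by_cases hz : c = false ∧ u = 0 ∧ d = 0 ∧ k = 0
    · obtain ⟨rfl, rfl, rfl, rfl⟩ := hz
      simp only [V, P, Finset.mem_singleton, Prod.mk.injEq]
      constructor
      · rintro ⟨rfl, rfl⟩; simp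
      · rintro ⟨-, h1, h2, -⟩
        exact ⟨Finset.card_eq_zero.1 h1, Finset.card_eq_zero.1 h2⟩
    · have : V 0 c u d k = ∅ := by
        unfold V; split <;> simp_all
      rw [this]
      simp only [Finset.notMem_empty, false_iff]
      intro h
      apply hz
      obtain ⟨h1, h2, h3, h4, h5, h6⟩ := h
      obtain ⟨⟨rfl, rfl⟩, rfl⟩ : (u = 0 ∧ d = 0) ∧ k = 0 := by omega
      have : B = ∅ := Finset.card_eq_zero.1 h3
      subst this
      cases c <;> simp_all
  | succ N ih =>
    have key : ∀ u d k (x : Finset ℕ × Finset ℕ), x ∈ V N false u d k ∪ V N true u d k ↔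
        ∃ c, P N c u d k x.1 x.2 := by
      intro u d k x
      rw [mem_union_V]
      exact exists_congr fun c => ih c u d k x.1 x.2
    intro c u d k A B
    constructor
    · intro h
      rcases c with _ | _
      · rcases u with _ | u
        · simp [V] at h
        · simp only [V, Finset.mem_image] at h
          obtain ⟨⟨A', B'⟩, h1, h2⟩ := h
          obtain ⟨c, h1⟩ := (key _ _ _ _).1 h1
          have hn := P_notMem h1
          have hle := P_le h1
          simp only [Prod.mk.injEq] at h1 h2 hn
          obtain ⟨rfl, rfl⟩ := h2
          have := h1.2.1
          have := h1.2.2.2.1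
          refine P_step N c false A' B' _ _ u d k _ _ _ (Or.inr rfl) (Or.inl rfl)
            (Finset.insert_union _ _ _) h1 (by omega) ?_ h1.2.2.1 (by omega) (by simpa using hn.2)
          rw [Finset.card_insert_of_notMem hn.1]; omega
      · simp only [V, Finset.mem_union] at h
        rcases h with h | h
        · split_ifs at h with hdu
          · rcases d with _ | d
            · simp at h
            · simp only [Finset.mem_image] at h
              obtain ⟨⟨A', B'⟩, h1, h2⟩ := h
              obtain ⟨c, h1⟩ := (key _ _ _ _).1 h1
              have hn := P_notMem h1
              simp only [Prod.mk.injEq] at h1 h2 hn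
              obtain ⟨rfl, rfl⟩ := h2
              have := h1.2.2.1
              have := h1.2.2.2.1
              refine P_step N c true A' B' _ _ u d k _ _ _ (Or.inl rfl) (Or.inr rfl)
                (Finset.union_insert _ _ _) h1 (by omega) h1.2.1 ?_ (by omega) (by simp)
              rw [Finset.card_insert_of_notMem hn.2]; omega
          · simp at h
        · rcases k with _ | k
          · simp at h
          · simp only [Finset.mem_image] at h
            obtain ⟨⟨A', B'⟩, h1, h2⟩ := h
            obtain ⟨c, h1⟩ := (key _ _ _ _).1 h1
            have hn := P_notMem h1
            have hle := P_le h1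
            simp only [Prod.mk.injEq] at h1 h2 hn
            obtain ⟨rfl, rfl⟩ := h2
            have := h1.2.1
            have := h1.2.2.1
            have := h1.2.2.2.1
            refine P_step N c true A' B' _ _ u d k _ _ _ (Or.inr rfl) (Or.inr rfl)
              (by ext; simp) h1 (by omega) ?_ ?_ (by omega) (by simp)
            · rw [Finset.card_insert_of_notMem hn.1]; omega
            · rw [Finset.card_insert_of_notMem hn.2]; omega
    · intro h
      have hsub := P_sub h
      have hle := P_le h
      obtain ⟨h1, h2, h3, h4, h5, h6⟩ := id h
      have hmem : N + 1 ∈ A ∪ B := by rw [h1]; simp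
      have cA : (A.erase (N + 1)).card ≤ N := by
        calc _ ≤ ((Finset.Icc 1 (N + 1)).erase (N + 1)).card :=
              Finset.card_le_card (Finset.erase_subset_erase _ hsub.1)
          _ = N := by rw [Finset.card_erase_of_mem (by simp)]; simp
      have cB : (B.erase (N + 1)).card ≤ N := by
        calc _ ≤ ((Finset.Icc 1 (N + 1)).erase (N + 1)).card :=
              Finset.card_le_card (Finset.erase_subset_erase _ hsub.2)
          _ = N := by rw [Finset.card_erase_of_mem (by simp)]; simp
      have cAB : N ≤ (A.erase (N + 1)).card + (B.erase (N + 1)).card := by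
        calc N = ((Finset.Icc 1 (N + 1)).erase (N + 1)).card := by
              rw [Finset.card_erase_of_mem (by simp)]; simp
          _ = (A.erase (N + 1) ∪ B.erase (N + 1)).card := by
              rw [← Finset.erase_union_distrib, h1]
          _ ≤ _ := Finset.card_union_le _ _
      rcases c with _ | _
      · have hB : N + 1 ∉ B := by simpa using h6
        have hA : N + 1 ∈ A := by simpa [hB] using hmem
        have eA := Finset.card_erase_add_one hA
        have eB := Finset.erase_eq_of_notMem hB
        rw [eB] at cB cAB
        rcases u with _ | u
        · omega
        · simp only [V, Finset.mem_image]
          refine ⟨(A.erase (N + 1), B.erase (N + 1)), (key _ _ _ _).2 ⟨_, P_back N _ A B _ _ _ u d k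
            h (by omega) (by omega) (by rw [eB]; omega)⟩, ?_⟩
          simp [Finset.insert_erase hA, eB]
      · have hB : N + 1 ∈ B := by simpa using h6
        have eB := Finset.card_erase_add_one hB
        simp only [V, Finset.mem_union]
        by_cases hA : N + 1 ∈ A
        · right
          have eA := Finset.card_erase_add_one hA
          rcases k with _ | k
          · omega
          · simp only [Finset.mem_image]
            refine ⟨(A.erase (N + 1), B.erase (N + 1)), (key _ _ _ _).2 ⟨_, P_back N _ A B _ _ _ u d
              k h (by omega) (by omega) (by omega)⟩, ?_⟩
            simp [Finset.insert_erase hA, Finset.insert_erase hB]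
        · left
          have eA := Finset.erase_eq_of_notMem hA
          rw [eA] at cA cAB
          rw [if_pos hle]
          rcases d with _ | d
          · omega
          · simp only [Finset.mem_image]
            refine ⟨(A.erase (N + 1), B.erase (N + 1)), (key _ _ _ _).2 ⟨_, P_back N _ A B _ _ _ u d
              k h (by omega) (by rw [eA]; omega) (by omega)⟩, ?_⟩
            simp [Finset.insert_erase hB, eA]

lemma am_B (A B : Finset ℕ) (N : ℕ) (hA : N + 2 ∉ A) : am (A, insert (N + 1) B) = am (A, B) := by
  simp only [am]
  rw [Finset.filter_insert, if_neg hA]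

lemma am_U (A B : Finset ℕ) (N : ℕ) (hA : N + 1 ∉ A) :
    am (insert (N + 1) A, B) = am (A, B) + if N ∈ B then N else 0 := by
  simp only [am]
  by_cases h : N ∈ B
  · rw [if_pos h]
    have : B.filter (fun i => i + 1 ∈ insert (N + 1) A) =
        insert N (B.filter (fun i => i + 1 ∈ A)) := by
      ext x
      simp only [Finset.mem_filter, Finset.mem_insert, Nat.add_right_cancel_iff]
      constructor
      · tauto
      · rintro (rfl | h') <;> tauto
    rw [this, Finset.sum_insert (by simp [hA]), add_comm]
  · rw [if_neg h, add_zero]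
    congr 1
    ext x
    simp only [Finset.mem_filter, Finset.mem_insert, Nat.add_right_cancel_iff]
    constructor
    · rintro ⟨h1, rfl | h2⟩ <;> tauto
    · tauto

/-- The weighted sums. -/
noncomputable def S (N : ℕ) (c : Bool) (u d k : ℕ) : Polynomial ℤ := ∑ x ∈ V N c u d k, X ^ am x

lemma V_disj (N u d k : ℕ) : Disjoint (V N false u d k) (V N true u d k) := by
  rw [Finset.disjoint_left]
  rintro ⟨A, B⟩ h1 h2
  rw [mem_V] at h1 h2
  have a := h1.2.2.2.2.2
  have b := h2.2.2.2.2.2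
  simp at a b
  exact a b

lemma mem_un {N u d k A B} (h : (A, B) ∈ V N false u d k ∪ V N true u d k) :
    ∃ c, P N c u d k A B := by
  obtain ⟨c, h⟩ := mem_union_V.1 h
  exact ⟨c, (mem_V _ _ _ _ _ _ _).1 h⟩

lemma inj_aux {A A' : Finset ℕ} {N : ℕ} (h1 : N ∉ A) (h2 : N ∉ A') (h : insert N A = insert N A') :
    A = A' := by
  rw [← Finset.erase_insert h1, h, Finset.erase_insert h2]

lemma P_notMem2 {N c u d k A B} (h : P N c u d k A B) : N + 2 ∉ A := by
  intro h'; have := Finset.mem_Icc.1 ((P_sub h).1 h'); omega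

lemma sum_D (N u d k : ℕ) :
    ∑ x ∈ (V N false u d k ∪ V N true u d k).image
      (fun x : Finset ℕ × Finset ℕ => (x.1, insert (N + 1) x.2)),
      (X : Polynomial ℤ) ^ am x = S N false u d k + S N true u d k := by
  rw [Finset.sum_image]
  · rw [S, S, ← Finset.sum_union (V_disj N u d k)]
    apply Finset.sum_congr rfl
    rintro ⟨A, B⟩ h
    obtain ⟨c, h⟩ := mem_un h
    rw [am_B _ _ _ (P_notMem2 h)]
  · rintro ⟨A, B⟩ h ⟨A', B'⟩ h' e
    obtain ⟨c, h⟩ := mem_un h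
    obtain ⟨c', h'⟩ := mem_un h'
    simp only [Prod.mk.injEq] at e ⊢
    exact ⟨e.1, inj_aux (P_notMem h).2 (P_notMem h').2 e.2⟩

lemma sum_Uaux (N u d k : ℕ) :
    ∑ x ∈ V N false u d k ∪ V N true u d k, (X : Polynomial ℤ) ^ am (insert (N + 1) x.1, x.2) =
      S N false u d k + X ^ N * S N true u d k := by
  rw [Finset.sum_union (V_disj N u d k), S, S, Finset.mul_sum]
  congr 1
  · apply Finset.sum_congr rfl
    rintro ⟨A, B⟩ h
    have h := (mem_V _ _ _ _ _ _ _).1 h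
    have hc := h.2.2.2.2.2
    rw [am_U _ _ _ (P_notMem h).1, if_neg (by simpa using hc), add_zero]
  · apply Finset.sum_congr rfl
    rintro ⟨A, B⟩ h
    have h := (mem_V _ _ _ _ _ _ _).1 h
    have hc := h.2.2.2.2.2
    rw [am_U _ _ _ (P_notMem h).1, if_pos (by simpa using hc), pow_add, mul_comm]

lemma sum_U (N u d k : ℕ) :
    ∑ x ∈ (V N false u d k ∪ V N true u d k).image
      (fun x : Finset ℕ × Finset ℕ => (insert (N + 1) x.1, x.2)),
      (X : Polynomial ℤ) ^ am x = S N false u d k + X ^ N * S N true u d k := by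
  rw [Finset.sum_image, sum_Uaux]
  rintro ⟨A, B⟩ h ⟨A', B'⟩ h' e
  obtain ⟨c, h⟩ := mem_un h
  obtain ⟨c', h'⟩ := mem_un h'
  simp only [Prod.mk.injEq] at e ⊢
  exact ⟨inj_aux (P_notMem h).1 (P_notMem h').1 e.1, e.2⟩

lemma sum_B (N u d k : ℕ) :
    ∑ x ∈ (V N false u d k ∪ V N true u d k).image
      (fun x : Finset ℕ × Finset ℕ => (insert (N + 1) x.1, insert (N + 1) x.2)),
      (X : Polynomial ℤ) ^ am x = S N false u d k + X ^ N * S N true u d k := by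
  rw [Finset.sum_image]
  · rw [← sum_Uaux]
    apply Finset.sum_congr rfl
    rintro ⟨A, B⟩ h
    obtain ⟨c, h⟩ := mem_un h
    rw [am_B]
    simp [P_notMem2 h]
  · rintro ⟨A, B⟩ h ⟨A', B'⟩ h' e
    obtain ⟨c, h⟩ := mem_un h
    obtain ⟨c', h'⟩ := mem_un h'
    simp only [Prod.mk.injEq] at e ⊢
    exact ⟨inj_aux (P_notMem h).1 (P_notMem h').1 e.1, inj_aux (P_notMem h).2 (P_notMem h').2 e.2⟩

lemma S_lt (N : ℕ) (c : Bool) (u d k : ℕ) (h : u < d) : S N c u d k = 0 := by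
  rw [S, Finset.sum_eq_zero]
  rintro ⟨A, B⟩ h'
  have := P_le ((mem_V _ _ _ _ _ _ _).1 h')
  omega

lemma S_eq : ∀ (N u d k : ℕ), u + d + k = N → d ≤ u →
    S N false u d k = fU u d k ∧ S N true u d k = fT u d k - fU u d k := by
  intro N
  induction N with
  | zero =>
    intro u d k h _
    obtain ⟨⟨rfl, rfl⟩, rfl⟩ : (u = 0 ∧ d = 0) ∧ k = 0 := by omega
    simp [S, V, fU, fT, totU, tot, tri, qBinom, am]
  | succ N ih =>
    intro u d k h hd
    constructor
    · rcases u with _ | u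
      · obtain rfl : d = 0 := by omega
        rw [fU_diag _ _ (by omega)]
        simp [S, V]
      · rw [S, V, sum_U]
        rcases Nat.lt_or_ge u d with h1 | h1
        · obtain rfl : d = u + 1 := by omega
          rw [fU_diag _ _ (by omega), S_lt _ _ _ _ _ h1, S_lt _ _ _ _ _ h1]; simp
        · obtain ⟨i1, i2⟩ := ih u d k (by omega) h1
          rw [i1, i2, fU_rec, show u + d + k = N by omega]
    · rw [S]
      simp only [V]
      rw [if_pos hd, Finset.sum_union, fT_rec _ _ _ (by omega)]
      · congr 1
        · rcases d with _ | d
          · simp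
          · simp only
            obtain ⟨i1, i2⟩ := ih u d k (by omega) (by omega)
            rw [sum_D, i1, i2]; ring
        · rcases k with _ | k
          · simp
          · simp only
            obtain ⟨i1, i2⟩ := ih u d k (by omega) hd
            rw [sum_B, i1, i2, fU_rec, show u + d + k = N by omega]
      · rw [Finset.disjoint_left]
        rintro ⟨A, B⟩ h1 h2
        rcases d with _ | d
        · simp at h1
        rcases k with _ | k
        · simp at h2
        simp only [Finset.mem_image, Prod.mk.injEq] at h1 h2
        obtain ⟨⟨A', B'⟩, h1, rfl, -⟩ := h1
        obtain ⟨⟨A'', B''⟩, h2, e, -⟩ := h2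
        obtain ⟨c, h1⟩ := mem_un h1
        apply (P_notMem h1).1
        simp only at e
        rw [← e]; simp

/-! ### Tableaux -/

lemma card_filt {n : ℕ} (a : Fin n → ℕ) (ha : StrictMono a) (v : ℕ) :
    ((Finset.image a Finset.univ).filter (· ≤ v)).card =
      (Finset.univ.filter (fun i => a i ≤ v)).card := by
  rw [Finset.filter_image, Finset.card_image_of_injective _ ha.injective]

lemma ballot_iff {n : ℕ} (a b : Fin n → ℕ) (ha : StrictMono a) (hb : StrictMono b) :
    (∀ i, a i ≤ b i) ↔ ∀ v, ((Finset.image b Finset.univ).filter (· ≤ v)).card ≤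
      ((Finset.image a Finset.univ).filter (· ≤ v)).card := by
  simp only [card_filt a ha, card_filt b hb]
  constructor
  · intro h v
    apply Finset.card_le_card
    intro i
    simp only [Finset.mem_filter, Finset.mem_univ, true_and]
    exact fun h' => (h i).trans h'
  · intro h i
    by_contra! hi
    have h1 := h (b i)
    have e1 : Finset.univ.filter (fun j => b j ≤ b i) = Finset.Iic i := by
      ext j; simp [hb.le_iff_le]
    have e2 : Finset.univ.filter (fun j => a j ≤ b i) ⊆ Finset.Iio i := by
      intro j
      simp only [Finset.mem_filter, Finset.mem_univ, true_and, Finset.mem_Iio]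
      intro hj
      exact ha.lt_iff_lt.1 (by omega)
    have e3 := Finset.card_le_card e2
    rw [e1] at h1
    simp at h1 e3
    omega

lemma bij (m k : ℕ) : Set.BijOn
    (fun T : (Fin (m + k) → ℕ) × (Fin (m + k) → ℕ) =>
      (Finset.image T.1 Finset.univ, Finset.image T.2 Finset.univ))
    (RInc (m + k) k)
    (↑(V (m + m + k) false m m k ∪ V (m + m + k) true m m k) : Set (Finset ℕ × Finset ℕ)) := by
  have hN : 2 * (m + k) - k = m + m + k := by omega
  refine ⟨?_, ?_, ?_⟩
  · rintro ⟨a, b⟩ ⟨ha, hb, hab, hr⟩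
    simp only at ha hb hab hr
    rw [Finset.mem_coe, mem_union_V]
    refine ⟨decide (m + m + k ∈ Finset.image b Finset.univ), (mem_V _ _ _ _ _ _ _).2
      ⟨?_, ?_, ?_, rfl, ?_, by simp⟩⟩
    · rw [← Finset.coe_inj]
      simpa [hN] using hr
    · rw [Finset.card_image_of_injective _ ha.injective]; simp
    · rw [Finset.card_image_of_injective _ hb.injective]; simp
    · exact fun v _ => (ballot_iff a b ha hb).1 hab v
  · rintro ⟨a, b⟩ ⟨ha, hb, -⟩ ⟨a', b'⟩ ⟨ha', hb', -⟩ e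
    simp only [Prod.mk.injEq] at *
    have e1 : Set.range a = Set.range a' := by
      have := congrArg (fun s : Finset ℕ => (s : Set ℕ)) e.1
      simpa using this
    have e2 : Set.range b = Set.range b' := by
      have := congrArg (fun s : Finset ℕ => (s : Set ℕ)) e.2
      simpa using this
    exact ⟨(StrictMono.range_inj ha ha').1 e1, (StrictMono.range_inj hb hb').1 e2⟩
  · rintro ⟨A, B⟩ h
    obtain ⟨c, h⟩ := mem_un h
    have hs := P_sub h
    obtain ⟨h1, h2, h3, -, h5, -⟩ := h
    have ia : Finset.image (A.orderEmbOfFin h2) Finset.univ = A := by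
      rw [← Finset.coe_inj]; simp
    have ib : Finset.image (B.orderEmbOfFin h3) Finset.univ = B := by
      rw [← Finset.coe_inj]; simp
    refine ⟨(A.orderEmbOfFin h2, B.orderEmbOfFin h3), ⟨(A.orderEmbOfFin h2).strictMono,
      (B.orderEmbOfFin h3).strictMono, ?_, ?_⟩, ?_⟩
    · apply (ballot_iff _ _ (A.orderEmbOfFin h2).strictMono (B.orderEmbOfFin h3).strictMono).2
      intro v
      simp only [ia, ib]
      rcases Nat.le_total v (m + m + k) with hv | hv
      · exact h5 v hv
      · rw [Finset.filter_true_of_mem, Finset.filter_true_of_mem, h2, h3]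
        · exact fun x hx => ((Finset.mem_Icc.1 (hs.1 hx)).2).trans hv
        · exact fun x hx => ((Finset.mem_Icc.1 (hs.2 hx)).2).trans hv
    · rw [hN]
      simp only [Finset.range_orderEmbOfFin]
      rw [← Finset.coe_union, h1, Finset.coe_Icc]
    · simp only [ia, ib]

lemma amaj_am {n : ℕ} (T : (Fin n → ℕ) × (Fin n → ℕ)) :
    amaj T = am (Finset.image T.1 Finset.univ, Finset.image T.2 Finset.univ) := by
  simp only [amaj, am]
  congr 1
  ext i
  simp

/-- [n−k+1]_q · Σ_{T ∈ RInc_k(2×n)} q^amaj(T)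
      = q^(k(k−1)/2) · [2n−k choose k]_q · [2n−2k choose n−k]_q. -/
theorem r2qnk (n k : ℕ) (hn : 1 ≤ n) (hk : k ≤ n) :
    qInt (n - k + 1) * ∑ᶠ T ∈ RInc n k, (X : Polynomial ℤ) ^ amaj T
      = X ^ (k * (k - 1) / 2) * (qBinom (2 * n - k) k
          * qBinom (2 * n - 2 * k) (n - k)) := by
  obtain ⟨m, rfl⟩ : ∃ m, n = m + k := ⟨n - k, by omega⟩
  have h1 : ∑ᶠ T ∈ RInc (m + k) k, (X : Polynomial ℤ) ^ amaj T = fT m m k := by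
    rw [finsum_mem_eq_of_bijOn _ (bij m k) (g := fun x => (X : Polynomial ℤ) ^ am x)
      (fun T _ => by rw [amaj_am]), finsum_mem_coe_finset, Finset.sum_union (V_disj _ _ _ _)]
    obtain ⟨i1, i2⟩ := S_eq (m + m + k) m m k rfl le_rfl
    rw [S] at i1 i2
    rw [i1, i2]; ring
  rw [h1, show m + k - k = m by omega, fT_final, tot, tri, Nat.choose_two_right,
    show 2 * (m + k) - k = m + m + k by omega, show 2 * (m + k) - 2 * k = m + m by omega]
end

section
/- For every positive integer n and every integer k with 0 ≤ k ≤ n, the number of increasing tableaux of shape 2×n with exactly k values appearing twice satisfies (n+1) · |Inc_k(2×n)| = C(n−1, k) · C(2n−k, n), where C denotes the ordinary binomial coefficient. -/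
/-- Increasing tableaux of shape 2×n with entry set `{1, …, 2n−k}`:
rows and columns strictly increasing. -/
def Inc (n k : ℕ) : Set ((Fin n → ℕ) × (Fin n → ℕ)) :=
  {T | StrictMono T.1 ∧ StrictMono T.2 ∧ (∀ i, T.1 i < T.2 i) ∧
    Set.range T.1 ∪ Set.range T.2 = Set.Icc 1 (2 * n - k)}

open Finset in
/-- Pairs of sets encoding the two rows, with prescribed cardinalities. -/
def GG (m : ℕ) (p q : ℤ) : Finset (Finset ℕ × Finset ℕ) :=
  ((Icc 1 m).powerset ×ˢ (Icc 1 m).powerset).filter (fun P =>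
    P.1 ∪ P.2 = Icc 1 m ∧ ((P.1.card : ℕ) : ℤ) = p ∧ ((P.2.card : ℕ) : ℤ) = q ∧
    ∀ v ∈ P.2, (P.2.filter (· ≤ v)).card ≤ (P.1.filter (· < v)).card)

lemma mem_GG (m : ℕ) (p q : ℤ) (A B : Finset ℕ) : (A, B) ∈ GG m p q ↔
    A ∪ B = Finset.Icc 1 m ∧ (A.card : ℤ) = p ∧ (B.card : ℤ) = q ∧
    ∀ v ∈ B, (B.filter (· ≤ v)).card ≤ (A.filter (· < v)).card := by
  unfold GG
  simp only [Finset.mem_filter, Finset.mem_product, Finset.mem_powerset]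
  constructor
  · exact fun h => h.2
  · intro h
    refine ⟨⟨?_, ?_⟩, h⟩
    · rw [← h.1]; exact Finset.subset_union_left
    · rw [← h.1]; exact Finset.subset_union_right

def gg (m : ℕ) (p q : ℤ) : ℤ := ((GG m p q).card : ℤ)

lemma gg_zero (p q : ℤ) : gg 0 p q = if p = 0 ∧ q = 0 then 1 else 0 := by
  unfold gg
  split_ifs with h
  · have : GG 0 p q = {(∅, ∅)} := by
      ext ⟨A, B⟩
      rw [mem_GG]
      simp only [Finset.mem_singleton, Prod.mk.injEq]
      constructor
      · rintro ⟨h1, -⟩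
        simpa [Finset.union_eq_empty] using h1
      · rintro ⟨rfl, rfl⟩
        simp [h.1, h.2]
    rw [this]; simp
  · have : GG 0 p q = ∅ := by
      ext ⟨A, B⟩
      rw [mem_GG]
      simp only [Finset.notMem_empty, iff_false]
      rintro ⟨h1, h2, h3, -⟩
      have h1 : A = ∅ ∧ B = ∅ := by simpa [Finset.union_eq_empty] using h1
      apply h
      rw [← h2, ← h3, h1.1, h1.2]; simp
    rw [this]; simp

lemma union_aux (m : ℕ) (A B C D : Finset ℕ) (hA : m + 1 ∉ A) (hB : m + 1 ∉ B)
    (h : C ∪ D = insert (m+1) (A ∪ B)) : C ∪ D = Finset.Icc 1 (m+1) ↔ A ∪ B = Finset.Icc 1 m := by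
  rw [h, ← Finset.insert_Icc_right_eq_Icc_add_one (by omega)]
  constructor
  · intro h
    have := congrArg (fun s => s.erase (m+1)) h
    simpa [Finset.erase_insert, hA, hB] using this
  · intro h; rw [h]

lemma le_of_union (m : ℕ) (A B : Finset ℕ) (h : A ∪ B = Finset.Icc 1 m) :
    (∀ x ∈ A, x ≤ m) ∧ (∀ x ∈ B, x ≤ m) := by
  constructor <;> intro x hx
  · have : x ∈ A ∪ B := Finset.mem_union_left _ hx
    rw [h] at this; exact (Finset.mem_Icc.1 this).2
  · have : x ∈ A ∪ B := Finset.mem_union_right _ hx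
    rw [h] at this; exact (Finset.mem_Icc.1 this).2

lemma fil1 (m v : ℕ) (A : Finset ℕ) (hv : v ≤ m + 1) :
    (insert (m+1) A).filter (· < v) = A.filter (· < v) := by
  rw [Finset.filter_insert, if_neg (by omega)]

lemma fil2 (m v : ℕ) (A : Finset ℕ) (hv : v ≤ m) :
    (insert (m+1) A).filter (· ≤ v) = A.filter (· ≤ v) := by
  rw [Finset.filter_insert, if_neg (by omega)]

lemma step1 (m : ℕ) (p q : ℤ) (A B : Finset ℕ) (hA : m + 1 ∉ A) (hB : m + 1 ∉ B) :
    (insert (m+1) A, B) ∈ GG (m+1) p q ↔ (A, B) ∈ GG m (p-1) q := by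
  rw [mem_GG, mem_GG, union_aux m A B _ _ hA hB (by rw [Finset.insert_union]),
    Finset.card_insert_of_notMem hA]
  push_cast
  refine and_congr_right fun h => and_congr (by constructor <;> intro h <;> linarith)
    (and_congr_right fun _ => forall₂_congr fun v hv => ?_)
  have := (le_of_union m A B h).2 v hv
  rw [fil1 m v A (by omega)]

lemma step2 (m : ℕ) (p q : ℤ) (A B : Finset ℕ) (hA : m + 1 ∉ A) (hB : m + 1 ∉ B) :
    (A, insert (m+1) B) ∈ GG (m+1) p q ↔ (q ≤ p ∧ (A, B) ∈ GG m p (q-1)) := by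
  rw [mem_GG, mem_GG, union_aux m A B _ _ hA hB (by rw [Finset.union_insert]),
    Finset.card_insert_of_notMem hB]
  push_cast
  rw [Finset.forall_mem_insert]
  rw [and_left_comm (a := q ≤ p)]
  refine and_congr_right fun h => ?_
  have hle := le_of_union m A B h
  have e1 : (insert (m+1) B).filter (· ≤ m+1) = insert (m+1) B := by
    apply Finset.filter_true_of_mem
    intro x hx
    rcases Finset.mem_insert.1 hx with rfl | hx
    · rfl
    · have := hle.2 x hx; omega
  have e2 : A.filter (· < m+1) = A := by
    apply Finset.filter_true_of_mem
    intro x hx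
    have := hle.1 x hx; omega
  rw [e1, e2, Finset.card_insert_of_notMem hB]
  have e3 : (∀ v ∈ B, ((insert (m+1) B).filter (· ≤ v)).card ≤ (A.filter (· < v)).card) ↔
      (∀ v ∈ B, (B.filter (· ≤ v)).card ≤ (A.filter (· < v)).card) := by
    refine forall₂_congr fun v hv => ?_
    rw [fil2 m v B (hle.2 v hv)]
  rw [e3]
  constructor
  · rintro ⟨a, b, c, d⟩; exact ⟨by omega, a, by omega, d⟩
  · rintro ⟨a, b, c, d⟩; exact ⟨b, by omega, by omega, d⟩

lemma step3 (m : ℕ) (p q : ℤ) (A B : Finset ℕ) (hA : m + 1 ∉ A) (hB : m + 1 ∉ B) :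
    (insert (m+1) A, insert (m+1) B) ∈ GG (m+1) p q ↔ (q < p ∧ (A, B) ∈ GG m (p-1) (q-1)) := by
  have key : (insert (m+1) A, insert (m+1) B) ∈ GG (m+1) p q ↔
      (A, insert (m+1) B) ∈ GG (m+1) (p-1) q := by
    rw [mem_GG, mem_GG, union_aux m A B _ _ hA hB (by ext; simp),
      union_aux m A B A (insert (m+1) B) hA hB (by rw [Finset.union_insert]),
      Finset.card_insert_of_notMem hA]
    push_cast
    refine and_congr_right fun h => and_congr (by constructor <;> intro h <;> linarith)
      (and_congr_right fun _ => forall₂_congr fun v hv => ?_)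
    have hle := le_of_union m A B h
    have : v ≤ m + 1 := by
      rcases Finset.mem_insert.1 hv with rfl | hx
      · rfl
      · have := hle.2 v hx; omega
    rw [fil1 m v A (by omega)]
  rw [key, step2 m _ _ A B hA hB]
  refine and_congr_left fun _ => ?_
  omega

lemma notMem_of_mem (m : ℕ) (p q : ℤ) (A B : Finset ℕ) (h : (A, B) ∈ GG m p q) :
    m + 1 ∉ A ∧ m + 1 ∉ B := by
  have := le_of_union m A B ((mem_GG _ _ _ _ _).1 h).1
  constructor <;> intro h
  · have := this.1 _ h; omega
  · have := this.2 _ h; omega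

lemma gg_succ (m : ℕ) (p q : ℤ) : gg (m+1) p q =
    gg m (p-1) q + (if q ≤ p then gg m p (q-1) else 0) +
      (if q < p then gg m (p-1) (q-1) else 0) := by
  classical
  have hu : GG (m+1) p q =
      ((GG m (p-1) q).image (fun P => (insert (m+1) P.1, P.2)) ∪
      (if q ≤ p then GG m p (q-1) else ∅).image (fun P => (P.1, insert (m+1) P.2))) ∪
      (if q < p then GG m (p-1) (q-1) else ∅).image
        (fun P => (insert (m+1) P.1, insert (m+1) P.2)) := by
    ext ⟨A, B⟩
    simp only [Finset.mem_union, Finset.mem_image, Prod.exists, Prod.mk.injEq]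
    constructor
    · intro h
      have hmem : m + 1 ∈ A ∪ B := by
        rw [((mem_GG _ _ _ _ _).1 h).1]; simp
      by_cases hA : m + 1 ∈ A
      · by_cases hB : m + 1 ∈ B
        · right
          refine ⟨A.erase (m+1), B.erase (m+1), ?_, Finset.insert_erase hA, Finset.insert_erase hB⟩
          have := (step3 m p q (A.erase (m+1)) (B.erase (m+1)) (by simp) (by simp)).1
            (by rwa [Finset.insert_erase hA, Finset.insert_erase hB])
          rw [if_pos this.1]; exact this.2
        · left; left
          refine ⟨A.erase (m+1), B, ?_, Finset.insert_erase hA, rfl⟩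
          exact (step1 m p q (A.erase (m+1)) B (by simp) hB).1
            (by rwa [Finset.insert_erase hA])
      · have hB : m + 1 ∈ B := by
          rcases Finset.mem_union.1 hmem with h | h
          · exact absurd h hA
          · exact h
        left; right
        refine ⟨A, B.erase (m+1), ?_, rfl, Finset.insert_erase hB⟩
        have := (step2 m p q A (B.erase (m+1)) hA (by simp)).1
            (by rwa [Finset.insert_erase hB])
        rw [if_pos this.1]; exact this.2
    · rintro ((⟨a, b, h, rfl, rfl⟩ | ⟨a, b, h, rfl, rfl⟩) | ⟨a, b, h, rfl, rfl⟩)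
      · have h' := notMem_of_mem _ _ _ _ _ h
        exact (step1 m p q a b h'.1 h'.2).2 h
      · split_ifs at h with hc
        · have h' := notMem_of_mem _ _ _ _ _ h
          exact (step2 m p q a b h'.1 h'.2).2 ⟨hc, h⟩
        · simp at h
      · split_ifs at h with hc
        · have h' := notMem_of_mem _ _ _ _ _ h
          exact (step3 m p q a b h'.1 h'.2).2 ⟨hc, h⟩
        · simp at h
  have nm2 : ∀ a b, (a, b) ∈ (if q ≤ p then GG m p (q-1) else ∅) → m + 1 ∉ a ∧ m + 1 ∉ b := by
    intro a b h
    split_ifs at h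
    · exact notMem_of_mem _ _ _ _ _ h
    · simp at h
  have nm3 : ∀ a b, (a, b) ∈ (if q < p then GG m (p-1) (q-1) else ∅) →
      m + 1 ∉ a ∧ m + 1 ∉ b := by
    intro a b h
    split_ifs at h
    · exact notMem_of_mem _ _ _ _ _ h
    · simp at h
  have ins : ∀ a b : Finset ℕ, m + 1 ∉ a → m + 1 ∉ b → insert (m+1) a = insert (m+1) b → a = b := by
    intro a b ha hb h
    have := congrArg (fun s => s.erase (m+1)) h
    simpa [Finset.erase_insert, ha, hb] using this
  unfold gg
  rw [hu, Finset.card_union_of_disjoint, Finset.card_union_of_disjoint,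
    Finset.card_image_of_injOn, Finset.card_image_of_injOn, Finset.card_image_of_injOn]
  · split_ifs <;> simp
  · rintro ⟨a, b⟩ h ⟨a', b'⟩ h' e
    have h := nm3 _ _ h
    have h' := nm3 _ _ h'
    simp only [Prod.mk.injEq] at e ⊢
    exact ⟨ins _ _ h.1 h'.1 e.1, ins _ _ h.2 h'.2 e.2⟩
  · rintro ⟨a, b⟩ h ⟨a', b'⟩ h' e
    have h := nm2 _ _ h
    have h' := nm2 _ _ h'
    simp only [Prod.mk.injEq] at e ⊢
    exact ⟨e.1, ins _ _ h.2 h'.2 e.2⟩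
  · rintro ⟨a, b⟩ h ⟨a', b'⟩ h' e
    have h := notMem_of_mem _ _ _ _ _ h
    have h' := notMem_of_mem _ _ _ _ _ h'
    simp only [Prod.mk.injEq] at e ⊢
    exact ⟨ins _ _ h.1 h'.1 e.1, e.2⟩
  · rw [Finset.disjoint_left]
    rintro ⟨A, B⟩ h1 h2
    simp only [Finset.mem_image, Prod.exists, Prod.mk.injEq] at h1 h2
    obtain ⟨a, b, h, rfl, rfl⟩ := h1
    obtain ⟨a', b', h', e1, e2⟩ := h2
    apply (notMem_of_mem _ _ _ _ _ h).2
    rw [← e2]; simp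
  · rw [Finset.disjoint_left]
    rintro ⟨A, B⟩ h1 h2
    simp only [Finset.mem_union, Finset.mem_image, Prod.exists, Prod.mk.injEq] at h1 h2
    obtain ⟨a', b', h', e1, e2⟩ := h2
    rcases h1 with ⟨a, b, h, rfl, rfl⟩ | ⟨a, b, h, rfl, rfl⟩
    · apply (notMem_of_mem _ _ _ _ _ h).2
      rw [← e2]; simp
    · apply (nm2 _ _ h).1
      rw [← e1]; simp

/-- trinomial coefficients -/
def TT : ℕ → ℤ → ℤ → ℤ
  | 0, p, q => if p = 0 ∧ q = 0 then 1 else 0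
  | m+1, p, q => TT m (p-1) q + TT m p (q-1) + TT m (p-1) (q-1)

lemma TT_symm (m : ℕ) : ∀ p q, TT m p q = TT m q p := by
  induction m with
  | zero => intro p q; simp only [TT, and_comm]
  | succ m ih =>
    intro p q
    simp only [TT]
    rw [ih (p-1) q, ih p (q-1), ih (p-1) (q-1)]; ring

lemma TT_vanish (m : ℕ) : ∀ p q : ℤ, (m < p ∨ m < q ∨ p + q < m) → TT m p q = 0 := by
  induction m with
  | zero =>
    intro p q h
    simp only [TT]
    rw [if_neg]; push_cast at h; omega
  | succ m ih =>
    intro p q h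
    push_cast at h
    simp only [TT]
    rw [ih (p-1) q (by omega), ih p (q-1) (by omega), ih (p-1) (q-1) (by omega)]; simp

open Nat in
lemma TT_fact (m : ℕ) : ∀ u d j : ℕ, u + d + j = m → ∀ p q : ℤ, p = u + j → q = d + j →
    TT m p q * (u ! * d ! * j !) = m ! := by
  induction m with
  | zero =>
    intro u d j h p q hp hq
    obtain ⟨rfl, rfl, rfl⟩ : u = 0 ∧ d = 0 ∧ j = 0 := by omega
    simp [TT, hp, hq]
  | succ m ih =>
    intro u d j h p q hp hq
    have h1 : TT m (p-1) q * (u ! * d ! * j !) = u * m ! := by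
      rcases u with _ | u
      · rw [TT_vanish _ _ _ (by push_cast at *; omega)]; simp
      · rw [← ih u d j (by omega) (p-1) q (by push_cast at *; omega) hq, Nat.factorial_succ]
        push_cast; ring
    have h2 : TT m p (q-1) * (u ! * d ! * j !) = d * m ! := by
      rcases d with _ | d
      · rw [TT_vanish _ _ _ (by push_cast at *; omega)]; simp
      · rw [← ih u d j (by omega) p (q-1) hp (by push_cast at *; omega), Nat.factorial_succ]
        push_cast; ring
    have h3 : TT m (p-1) (q-1) * (u ! * d ! * j !) = j * m ! := by
      rcases j with _ | j
      · rw [TT_vanish _ _ _ (by push_cast at *; omega)]; simp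
      · rw [← ih u d j (by omega) (p-1) (q-1) (by push_cast at *; omega)
          (by push_cast at *; omega), Nat.factorial_succ]
        push_cast; ring
    simp only [TT]
    rw [add_mul, add_mul, h1, h2, h3, Nat.factorial_succ, ← h]
    push_cast; ring

lemma gg_vanish (m : ℕ) : ∀ p q : ℤ, (p < q ∨ p + q < m) → gg m p q = 0 := by
  induction m with
  | zero => intro p q h; rw [gg_zero, if_neg]; push_cast at h; omega
  | succ m ih =>
    intro p q h
    push_cast at h
    rw [gg_succ, ih (p-1) q (by omega)]
    have h2 : (if q ≤ p then gg m p (q-1) else 0) = 0 := by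
      split_ifs
      · exact ih _ _ (by omega)
      · rfl
    have h3 : (if q < p then gg m (p-1) (q-1) else 0) = 0 := by
      split_ifs
      · exact ih _ _ (by omega)
      · rfl
    rw [h2, h3]; rfl

lemma gg_main (m : ℕ) : ∀ p q : ℤ, q ≤ p →
    gg m p q + gg m p (q-1) = TT m p q - TT m (p+1) (q-1) := by
  induction m with
  | zero =>
    intro p q h
    rw [gg_zero, gg_zero]
    simp only [TT]
    rw [if_neg (c := p = 0 ∧ q - 1 = 0) (by omega), if_neg (c := p + 1 = 0 ∧ q - 1 = 0) (by omega)]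
    ring
  | succ m ih =>
    intro p q h
    rw [gg_succ, gg_succ]
    simp only [TT]
    rw [if_pos h, if_pos (show q - 1 ≤ p by omega), if_pos (show q - 1 < p by omega)]
    have e1 := ih p (q-1) (by omega)
    have e2 := ih (p-1) (q-1) (by omega)
    rw [show p - 1 + 1 = p by ring] at e2
    rw [show p + 1 - 1 = p by ring]
    rcases h.lt_or_eq with h | rfl
    · rw [if_pos h]
      have e3 := ih (p-1) q (by omega)
      rw [show p - 1 + 1 = p by ring] at e3
      linarith
    · rw [if_neg (by omega), gg_vanish m (q-1) q (by omega)]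
      have := TT_symm m (q-1) q
      linarith

lemma gg_diag (m : ℕ) (n : ℤ) :
    gg m n n + gg (m+1) n n = TT m n n - TT m (n+1) (n-1) := by
  rw [← gg_main m n n le_rfl, gg_succ, gg_vanish m (n-1) n (by omega)]
  simp

open Nat in
lemma M_fact (d k : ℕ) (n : ℤ) (hn : n = d + k) :
    (TT (2*d+k) n n - TT (2*d+k) (n+1) (n-1)) * ((d+1)! * d ! * k !) = (2*d+k)! := by
  have h1 := TT_fact (2*d+k) d d k (by omega) n n hn hn
  have h2 : TT (2*d+k) (n+1) (n-1) * ((d+1)! * d ! * k !) = d * (2*d+k)! := by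
    rcases d with _ | d
    · rw [TT_vanish _ _ _ (by push_cast at *; omega)]; simp
    · rw [← TT_fact (2*(d+1)+k) (d+2) d k (by omega) (n+1) (n-1) (by push_cast at *; omega)
        (by push_cast at *; omega), Nat.factorial_succ d]
      push_cast; ring
  rw [sub_mul, h2, Nat.factorial_succ d]
  push_cast
  linear_combination (d+1 : ℤ) * h1

open Nat in
lemma gg_formula (n : ℕ) (hn : 1 ≤ n) (k : ℕ) : k ≤ n →
    ((n:ℤ) + 1) * gg (2*n-k) n n = (Nat.choose (n-1) k * Nat.choose (2*n-k) n : ℕ) := by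
  induction k with
  | zero =>
    intro _
    have h := gg_diag (2*n) n
    rw [gg_vanish (2*n+1) n n (by push_cast; omega)] at h
    have h2 := M_fact n 0 n (by simp)
    simp only [Nat.add_zero, Nat.sub_zero] at *
    rw [← h] at h2
    have h3 := Nat.add_choose_mul_factorial_mul_factorial n n
    rw [← two_mul] at h3
    have h3 : ((2*n).choose n : ℤ) * n ! * n ! = (2*n)! := by exact_mod_cast h3
    rw [← h3, Nat.factorial_succ] at h2
    have : (n ! : ℤ) ≠ 0 := by exact_mod_cast Nat.factorial_ne_zero n
    simp only [Nat.choose_zero_right]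
    push_cast at *
    apply mul_right_cancel₀ (mul_ne_zero this this)
    simp at h2
    linear_combination h2
  | succ k ih =>
    intro hk
    have ih := ih (by omega)
    obtain ⟨d, rfl⟩ := Nat.exists_eq_add_of_le hk
    have h := gg_diag (2*(k+1+d)-(k+1)) ((k+1+d : ℕ) : ℤ)
    have e1 : 2*(k+1+d)-(k+1) = 2*d+(k+1) := by omega
    have e2 : 2*(k+1+d)-k = 2*d+(k+1)+1 := by omega
    rw [e1] at h ⊢
    rw [e2] at ih
    have h2 := M_fact d (k+1) ((k+1+d : ℕ) : ℤ) (by push_cast; ring)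
    rw [← h] at h2
    set x := gg (2*d+(k+1)) ((k+1+d : ℕ) : ℤ) ((k+1+d : ℕ) : ℤ)
    set y := gg (2*d+(k+1)+1) ((k+1+d : ℕ) : ℤ) ((k+1+d : ℕ) : ℤ)
    have e3 : k+1+d-1 = k + d := by omega
    rw [e3] at ih ⊢
    have c1 : ((k+d).choose k : ℤ) * k ! * d ! = (k+d)! := by
      have := Nat.add_choose_mul_factorial_mul_factorial k d
      rw [Nat.choose_symm_of_eq_add (show k+d = d + k by ring)] at this
      exact_mod_cast this
    have c2 : ((k+d).choose (k+1) : ℤ) * (k+1) = (k+d).choose k * d := by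
      have := Nat.choose_succ_right_eq (k+d) k
      rw [Nat.add_sub_cancel_left] at this
      exact_mod_cast this
    have c3 : ((2*d+(k+1)).choose (k+1+d) : ℤ) * (k+1+d)! * d ! = (2*d+(k+1))! := by
      have := Nat.add_choose_mul_factorial_mul_factorial (k+1+d) d
      rw [Nat.choose_symm_of_eq_add (show k+1+d+d = d + (k+1+d) by ring),
        show k+1+d+d = 2*d+(k+1) by ring] at this
      exact_mod_cast this
    have c4 : ((2*d+(k+1)+1).choose (k+1+d) : ℤ) * (d+1) =
        (2*d+(k+1)).choose (k+1+d) * (2*d+(k+1)+1) := by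
      have := Nat.add_one_mul_choose_eq (2*d+(k+1)) (d)
      have s1 : (2*d+(k+1)).choose d = (2*d+(k+1)).choose (k+1+d) :=
        Nat.choose_symm_of_eq_add (by ring)
      have s2 : (2*d+(k+1)+1).choose (d+1) = (2*d+(k+1)+1).choose (k+1+d) :=
        Nat.choose_symm_of_eq_add (by ring)
      rw [s1, s2] at this
      have : ((2*d+(k+1)+1 : ℕ) : ℤ) * (2*d+(k+1)).choose (k+1+d)
        = (2*d+(k+1)+1).choose (k+1+d) * (d+1) := by exact_mod_cast this
      push_cast at this
      linarith
    rw [← c3] at h2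
    have f1 : ((k+1+d)! : ℤ) = (k+1+d) * (k+d)! := by
      rw [show k+1+d = (k+d)+1 by ring, Nat.factorial_succ]; push_cast; ring
    rw [f1, ← c1, Nat.factorial_succ d, Nat.factorial_succ k] at h2
    have nk : (k ! : ℤ) ≠ 0 := by exact_mod_cast Nat.factorial_ne_zero k
    have nd : (d ! : ℤ) ≠ 0 := by exact_mod_cast Nat.factorial_ne_zero d
    push_cast at *
    set P : ℤ := ((k+d).choose k : ℤ)
    set P' : ℤ := ((k+d).choose (k+1) : ℤ)
    set C : ℤ := ((2*d+(k+1)).choose (k+1+d) : ℤ)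
    set C' : ℤ := ((2*d+(k+1)+1).choose (k+1+d) : ℤ)
    have h3 : (x + y) * ((d+1) * (k+1)) = C * (k+1+d) * P := by
      apply mul_right_cancel₀ (mul_ne_zero nk (mul_ne_zero nd nd))
      linear_combination h2
    have nn : ((d:ℤ)+1) * (k+1) ≠ 0 := by positivity
    apply mul_right_cancel₀ nn
    linear_combination ((k:ℤ)+1+d+1) * h3 - (d+1) * (k+1) * ih - C * (d+1) * c2 - P * (k+1) * c4

/-- the entrywise condition in terms of ranges -/
lemma cond_iff (n : ℕ) (a b : Fin n → ℕ) (ha : StrictMono a) (hb : StrictMono b) :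
    (∀ i, a i < b i) ↔ ∀ v ∈ Finset.univ.image b,
      ((Finset.univ.image b).filter (· ≤ v)).card ≤ ((Finset.univ.image a).filter (· < v)).card := by
  have key : ∀ i, ((Finset.univ.image b).filter (· ≤ b i)).card = i + 1 := by
    intro i
    rw [Finset.filter_image, Finset.card_image_of_injective _ hb.injective]
    simp only [hb.le_iff_le]
    rw [show (Finset.univ.filter (fun x => x ≤ i)) = Finset.Iic i by ext; simp, Fin.card_Iic]
  constructor
  · intro h v hv
    obtain ⟨i, -, rfl⟩ := Finset.mem_image.1 hv
    rw [key, Finset.filter_image, Finset.card_image_of_injective _ ha.injective, ← Fin.card_Iic]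
    apply Finset.card_le_card
    intro j hj
    simp only [Finset.mem_Iic] at hj
    simp only [Finset.mem_filter, Finset.mem_univ, true_and]
    exact lt_of_le_of_lt (ha.monotone hj) (h i)
  · intro h i
    by_contra hc
    have h1 := h (b i) (by simp)
    rw [key, Finset.filter_image, Finset.card_image_of_injective _ ha.injective] at h1
    have h2 : (Finset.univ.filter (fun x => a x < b i)) ⊆ Finset.Iio i := by
      intro j hj
      simp only [Finset.mem_filter, Finset.mem_univ, true_and] at hj
      simp only [Finset.mem_Iio]
      by_contra hij
      exact hc (lt_of_le_of_lt (ha.monotone (not_lt.1 hij)) hj)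
    have := Finset.card_le_card h2
    rw [Fin.card_Iio] at this
    omega

lemma mem_Inc_iff (n k : ℕ) (a b : Fin n → ℕ) (ha : StrictMono a) (hb : StrictMono b) :
    (a, b) ∈ Inc n k ↔ (Finset.univ.image a, Finset.univ.image b) ∈ GG (2*n-k) n n := by
  rw [mem_GG, ← cond_iff n a b ha hb, Finset.card_image_of_injective _ ha.injective,
    Finset.card_image_of_injective _ hb.injective, ← Finset.coe_inj]
  simp [Inc, ha, hb, and_comm]

lemma inc_card (n k : ℕ) : ((Inc n k).ncard : ℤ) = gg (2*n-k) n n := by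
  unfold gg
  rw [← Set.ncard_coe_finset]
  congr 1
  refine Set.ncard_congr (fun T _ => (Finset.univ.image T.1, Finset.univ.image T.2)) ?_ ?_ ?_
  · rintro ⟨a, b⟩ h
    exact (mem_Inc_iff n k a b h.1 h.2.1).1 h
  · rintro ⟨a, b⟩ ⟨a', b'⟩ h h' e
    simp only [Prod.mk.injEq, ← Finset.coe_inj, Finset.coe_image, Finset.coe_univ,
      Set.image_univ] at e ⊢
    exact ⟨(h.1.range_inj h'.1).1 e.1, (h.2.1.range_inj h'.2.1).1 e.2⟩
  · rintro ⟨A, B⟩ h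
    have h' := (mem_GG _ _ _ _ _).1 h
    have hA : A.card = n := by exact_mod_cast h'.2.1
    have hB : B.card = n := by exact_mod_cast h'.2.2.1
    have iA : Finset.univ.image (A.orderEmbOfFin hA) = A := by
      rw [← Finset.coe_inj]; simp
    have iB : Finset.univ.image (B.orderEmbOfFin hB) = B := by
      rw [← Finset.coe_inj]; simp
    refine ⟨(A.orderEmbOfFin hA, B.orderEmbOfFin hB), ?_, ?_⟩
    · rw [mem_Inc_iff n k _ _ (OrderEmbedding.strictMono _) (OrderEmbedding.strictMono _), iA, iB]
      exact h
    · simp only [iA, iB]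

/-- (n+1) · |Inc_k(2×n)| = C(n−1, k) · C(2n−k, n). -/
theorem snk (n k : ℕ) (hn : 1 ≤ n) (hk : k ≤ n) :
    (n + 1) * (Inc n k).ncard = Nat.choose (n - 1) k * Nat.choose (2 * n - k) n := by
  have h := gg_formula n hn k hk
  rw [← inc_card] at h
  exact_mod_cast h
end
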